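/- Let T > 0, ξ ∈ C¹([0,T]), let H ∈ C²(ℝ) be convex and even with H(0) = 0, let F ∈ C²(ℝ) be odd with F' > 0, and set G(r) := ∫_0^r (F'(w) H''(w))^{1/2} dw. Let u be a smooth classical solution of du = ∂_x(F(∂_x u)) dt + H(∂_x u) dξ on 𝕋 × [0,T]. Then, whenever Γ(ξ)_{0,T} > 0, ∥G(∂_x u(·,T))∥_∞² ≤ osc(u(·,0)) / Γ(ξ)_{0,T}. -/

import Mathlib

open Set MeasureTheory intervalIntegral

/-- A smooth classical solution of `du = ∂ₓ(F(∂ₓu)) dt + H(∂ₓu) dξ` on `𝕋 × I`, where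
`𝕋 = ℝ/ℤ` is realized as `1`-periodic functions of `x ∈ ℝ`: a function `u`,
`C³` in `x` and `C¹` in `t` (on `I`) with `∂ₜ∂ₓu` continuous, with space derivatives
`ux`, `uxx`, `uxxx`, time derivative `ut` and mixed derivative `utx`, satisfying
`∂ₜu = ∂ₓ(F(∂ₓu)) + H(∂ₓu)·ξ'(t)` pointwise. -/
structure IsSmoothClassicalSolution (I : Set ℝ) (ξ F H : ℝ → ℝ)
    (u ux uxx uxxx ut utx : ℝ → ℝ → ℝ) : Prop where
  periodic : ∀ x t, u (x + 1) t = u x t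
  deriv_x : ∀ x : ℝ, ∀ t ∈ I, HasDerivAt (fun y => u y t) (ux x t) x
  deriv_xx : ∀ x : ℝ, ∀ t ∈ I, HasDerivAt (fun y => ux y t) (uxx x t) x
  deriv_xxx : ∀ x : ℝ, ∀ t ∈ I, HasDerivAt (fun y => uxx y t) (uxxx x t) x
  deriv_t : ∀ x : ℝ, ∀ t ∈ I, HasDerivWithinAt (fun s => u x s) (ut x t) I t
  deriv_tx : ∀ x : ℝ, ∀ t ∈ I, HasDerivWithinAt (fun s => ux x s) (utx x t) I t
  cont_u : ContinuousOn (fun p : ℝ × ℝ => u p.1 p.2) (Set.univ ×ˢ I)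
  cont_ux : ContinuousOn (fun p : ℝ × ℝ => ux p.1 p.2) (Set.univ ×ˢ I)
  cont_uxx : ContinuousOn (fun p : ℝ × ℝ => uxx p.1 p.2) (Set.univ ×ˢ I)
  cont_uxxx : ContinuousOn (fun p : ℝ × ℝ => uxxx p.1 p.2) (Set.univ ×ˢ I)
  cont_ut : ContinuousOn (fun p : ℝ × ℝ => ut p.1 p.2) (Set.univ ×ˢ I)
  cont_utx : ContinuousOn (fun p : ℝ × ℝ => utx p.1 p.2) (Set.univ ×ˢ I)
  pde : ∀ x : ℝ, ∀ t ∈ I,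
    ut x t = deriv (fun y => F (ux y t)) x + H (ux x t) * deriv ξ t

/-- The oscillation of a function on `[a, b]`. -/
noncomputable def oscOn (f : ℝ → ℝ) (a b : ℝ) : ℝ :=
  sSup (f '' Set.Icc a b) - sInf (f '' Set.Icc a b)

/-- `t(s) ∧ T`, where `t(s) := inf {r > s : ξ r < ξ s}` (with `inf ∅ := +∞`);
encoded as `inf ({r > s : ξ r < ξ s} ∪ {T})`, which coincides with `t(s) ∧ T`. -/
noncomputable def descentTime (ξ : ℝ → ℝ) (s T : ℝ) : ℝ :=
  sInf ({r : ℝ | s < r ∧ ξ r < ξ s} ∪ {T})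

/-- `Γ(ξ)_{S,T} := sup_{S ≤ s ≤ T} ∫_s^{t(s) ∧ T} (ξ u - ξ s) du`. -/
noncomputable def Gamma (ξ : ℝ → ℝ) (S T : ℝ) : ℝ :=
  sSup ((fun s => ∫ u in s..(descentTime ξ s T), (ξ u - ξ s)) '' Set.Icc S T)

lemma HasDerivAt.nonneg_of_forall_le_left {f : ℝ → ℝ} {d a t : ℝ} (hd : HasDerivAt f d t)
    (hat : a < t) (h : ∀ s ∈ Ioo a t, f s ≤ f t) : 0 ≤ d := by
  have h1 := (hasDerivWithinAt_iff_tendsto_slope' (s := Iio t) (by simp)).1 hd.hasDerivWithinAt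
  refine ge_of_tendsto h1 ?_
  filter_upwards [Ioo_mem_nhdsLT hat] with s hs
  rw [slope_def_field]
  exact div_nonneg_of_nonpos (by linarith [h s hs]) (by linarith [hs.2])

lemma IsLocalMax.second_deriv_nonpos {f f' : ℝ → ℝ} {f'' x : ℝ}
    (hf : ∀ y, HasDerivAt f (f' y) y) (hf' : HasDerivAt f' f'' x) (h : IsLocalMax f x) :
    f'' ≤ 0 := by
  by_contra! hpos
  have hfd : deriv f = f' := funext fun y => (hf y).deriv
  have h0 : f' x = 0 := h.hasDerivAt_eq_zero (hf x)
  have hmin : IsLocalMin f x := isLocalMin_of_deriv_deriv_pos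
    (by rw [hfd, hf'.deriv]; exact hpos) (by rw [hfd, h0]) (hf x).continuousAt
  have hconst : f =ᶠ[nhds x] fun _ => f x := by
    filter_upwards [h, hmin] with y hy1 hy2 using le_antisymm hy1 hy2
  have h1 := hconst.deriv
  rw [hfd] at h1
  have h2 := h1.deriv_eq
  rw [hf'.deriv] at h2
  simp at h2
  exact hpos.ne' h2

/-- The weak maximum principle on the cylinder `𝕋 × [a, b]`. -/
lemma le_of_parabolic_max_principle {a b M : ℝ} {w wx wxx wt : ℝ → ℝ → ℝ}
    (hper : ∀ t ∈ Icc a b, Function.Periodic (fun x => w x t) 1)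
    (hcont : ContinuousOn (fun p : ℝ × ℝ => w p.1 p.2) (univ ×ˢ Icc a b))
    (hx : ∀ x, ∀ t ∈ Ioo a b, HasDerivAt (fun y => w y t) (wx x t) x)
    (hxx : ∀ x, ∀ t ∈ Ioo a b, HasDerivAt (fun y => wx y t) (wxx x t) x)
    (ht : ∀ x, ∀ t ∈ Ioo a b, HasDerivAt (fun s => w x s) (wt x t) t)
    (h : ∀ x, ∀ t ∈ Ioo a b, wx x t = 0 → wxx x t ≤ 0 → wt x t ≤ 0)
    (hM : ∀ x, w x a ≤ M) : ∀ x, ∀ t ∈ Icc a b, w x t ≤ M := by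
  have key : ∀ x, ∀ t ∈ Ico a b, w x t ≤ M := by
    intro x₁ t₁ ht₁
    by_contra! hlt
    have hat : a < t₁ := by
      rcases ht₁.1.eq_or_lt with h0 | h0
      · rw [← h0] at hlt
        exact absurd (hM x₁) (not_le.2 hlt)
      · exact h0
    obtain ⟨ε, hε, hε'⟩ : ∃ ε > 0, M < w x₁ t₁ - ε * (t₁ - a) := by
      have hpos : 0 < t₁ - a := by linarith
      refine ⟨(w x₁ t₁ - M) / (2 * (t₁ - a)), by apply div_pos <;> linarith, ?_⟩
      have : (w x₁ t₁ - M) / (2 * (t₁ - a)) * (t₁ - a) = (w x₁ t₁ - M) / 2 := by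
        field_simp
      linarith
    have hK : IsCompact (Icc (0 : ℝ) 1 ×ˢ Icc a t₁) := isCompact_Icc.prod isCompact_Icc
    have hφ : ContinuousOn (fun p : ℝ × ℝ => w p.1 p.2 - ε * (p.2 - a))
        (Icc (0 : ℝ) 1 ×ˢ Icc a t₁) := by
      refine ContinuousOn.sub (hcont.mono ?_) (by fun_prop)
      exact prod_mono (subset_univ _) (Icc_subset_Icc_right ht₁.2.le)
    obtain ⟨⟨x₀, t₀⟩, hmem, hmax⟩ := hK.exists_isMaxOn
      ⟨(0, a), by simp [hat.le]⟩ hφ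
    have hmax' : ∀ x, ∀ t ∈ Icc a t₁,
        w x t - ε * (t - a) ≤ w x₀ t₀ - ε * (t₀ - a) := by
      intro x t htt
      obtain ⟨y, hy, hxy⟩ := (hper t ⟨htt.1, htt.2.trans ht₁.2.le⟩).exists_mem_Ico₀ one_pos x
      have h1 := hmax (show (y, t) ∈ Icc (0 : ℝ) 1 ×ˢ Icc a t₁ from ⟨⟨hy.1, hy.2.le⟩, htt⟩)
      have hxy' : w x t = w y t := hxy
      rw [hxy']
      exact h1
    have ht₀ : t₀ ∈ Icc a t₁ := hmem.2
    have hat₀ : a < t₀ := by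
      rcases ht₀.1.eq_or_lt with h0 | h0
      · have h1 := hmax' x₁ t₁ ⟨hat.le, le_rfl⟩
        rw [← h0] at h1
        linarith [hM x₀]
      · exact h0
    have ht₀' : t₀ ∈ Ioo a b := ⟨hat₀, ht₀.2.trans_lt ht₁.2⟩
    have hloc : IsLocalMax (fun y => w y t₀) x₀ :=
      Filter.Eventually.of_forall fun x => by linarith [hmax' x t₀ ht₀]
    have h0 := h x₀ t₀ ht₀' (hloc.hasDerivAt_eq_zero (hx x₀ t₀ ht₀'))
      (hloc.second_deriv_nonpos (fun y => hx y t₀ ht₀') (hxx x₀ t₀ ht₀'))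
    have hd : HasDerivAt (fun s => w x₀ s - ε * (s - a)) (wt x₀ t₀ - ε * 1) t₀ :=
      (ht x₀ t₀ ht₀').sub (((hasDerivAt_id t₀).sub_const a).const_mul ε)
    have := hd.nonneg_of_forall_le_left hat₀
      fun s hs => hmax' x₀ s ⟨hs.1.le, hs.2.le.trans ht₀.2⟩
    linarith
  intro x t htt
  rcases eq_or_lt_of_le (htt.1.trans htt.2) with hab | hab
  · have : t = a := le_antisymm (htt.2.trans hab.ge) htt.1
    exact this ▸ hM x
  · have hcl : closure (Ico a b) = Icc a b := closure_Ico hab.ne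
    have hc : ContinuousOn (fun s => w x s) (Icc a b) :=
      hcont.comp (f := fun s : ℝ => (x, s)) (by fun_prop) fun s hs => ⟨mem_univ _, hs⟩
    exact le_on_closure (f := fun s => w x s) (g := fun _ => M) (key x) (hcl ▸ hc)
      continuousOn_const (hcl ▸ htt)

lemma continuous_slice {f : ℝ → ℝ → ℝ} {I : Set ℝ}
    (hf : ContinuousOn (fun p : ℝ × ℝ => f p.1 p.2) (univ ×ˢ I)) {t : ℝ} (ht : t ∈ I) :
    Continuous fun x => f x t :=
  hf.comp_continuous (f := fun x : ℝ => (x, t)) (by fun_prop) fun _ => ⟨mem_univ _, ht⟩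

lemma continuousOn_integral_slice {f : ℝ → ℝ → ℝ} {a b : ℝ} (α β : ℝ)
    (hf : ContinuousOn (fun p : ℝ × ℝ => f p.1 p.2) (univ ×ˢ Icc a b)) :
    ContinuousOn (fun t => ∫ x in α..β, f x t) (Icc a b) := by
  rcases lt_or_ge b a with hab | hab
  · simp [Icc_eq_empty (not_le.2 hab)]
  have hc : Continuous (Function.uncurry fun t x : ℝ => f x (projIcc a b hab t)) :=
    hf.comp_continuous (f := fun p : ℝ × ℝ => (p.2, (projIcc a b hab p.1 : ℝ)))
      (by fun_prop) fun p => ⟨mem_univ _, (projIcc a b hab p.1).2⟩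
  refine (continuous_parametric_intervalIntegral_of_continuous' (μ := volume) hc α β).continuousOn.congr
    fun t ht => ?_
  simp [projIcc_of_mem hab ht]

lemma hasDerivAt_integral_slice {f f' : ℝ → ℝ → ℝ} {a b t : ℝ} (α β : ℝ)
    (hf : ContinuousOn (fun p : ℝ × ℝ => f p.1 p.2) (univ ×ˢ Icc a b))
    (hf' : ContinuousOn (fun p : ℝ × ℝ => f' p.1 p.2) (univ ×ˢ Icc a b))
    (hd : ∀ x, ∀ t ∈ Ioo a b, HasDerivAt (fun s => f x s) (f' x t) t) (ht : t ∈ Ioo a b) :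
    HasDerivAt (fun s => ∫ x in α..β, f x s) (∫ x in α..β, f' x t) t := by
  have hK : IsCompact (uIcc α β ×ˢ Icc a b) := isCompact_uIcc.prod isCompact_Icc
  obtain ⟨C, hC⟩ := hK.exists_bound_of_continuousOn (hf'.mono (prod_mono (subset_univ _) subset_rfl))
  refine (intervalIntegral.hasDerivAt_integral_of_dominated_loc_of_deriv_le (μ := volume)
    (F := fun s x => f x s) (F' := fun s x => f' x s) (s := Ioo a b) (bound := fun _ => C)
    (Ioo_mem_nhds ht.1 ht.2) ?_ ?_ ?_ ?_ ?_ ?_).2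
  · filter_upwards [Ioo_mem_nhds ht.1 ht.2] with s hs
    exact (continuous_slice hf (Ioo_subset_Icc_self hs)).aestronglyMeasurable
  · exact (continuous_slice hf (Ioo_subset_Icc_self ht)).intervalIntegrable _ _
  · exact (continuous_slice hf' (Ioo_subset_Icc_self ht)).aestronglyMeasurable
  · exact Filter.Eventually.of_forall fun x hx s hs =>
      hC (x, s) ⟨uIoc_subset_uIcc hx, Ioo_subset_Icc_self hs⟩
  · exact intervalIntegrable_const
  · exact Filter.Eventually.of_forall fun x _ s hs => hd x s hs

lemma sq_integral_le_integral_sq {f : ℝ → ℝ} (hf : Continuous f) :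
    (∫ x in (0 : ℝ)..1, f x) ^ 2 ≤ ∫ x in (0 : ℝ)..1, f x ^ 2 := by
  set c := ∫ x in (0 : ℝ)..1, f x with hc
  have h0 : 0 ≤ ∫ x in (0 : ℝ)..1, (f x - c) ^ 2 :=
    integral_nonneg zero_le_one fun x _ => sq_nonneg _
  have h1 : ∫ x in (0 : ℝ)..1, (f x - c) ^ 2 =
      (∫ x in (0 : ℝ)..1, f x ^ 2) - 2 * c * c + c ^ 2 := by
    have : ∀ x, (f x - c) ^ 2 = f x ^ 2 - 2 * c * f x + c ^ 2 := fun x => by ring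
    simp only [this]
    rw [intervalIntegral.integral_add, intervalIntegral.integral_sub,
      intervalIntegral.integral_const_mul, ← hc]
    · simp
    all_goals exact Continuous.intervalIntegrable (by fun_prop) _ _
  nlinarith

/-- The Sobolev embedding `H¹ ⊂ L^∞` on the unit interval, for functions with a zero. -/
lemma sq_le_integral_sq_of_zero {g g' : ℝ → ℝ} (hg : ∀ x, HasDerivAt g (g' x) x)
    (hg' : Continuous g') {x₀ y : ℝ} (hx₀ : x₀ ∈ Icc (0 : ℝ) 1) (hy : y ∈ Icc (0 : ℝ) 1)
    (h0 : g x₀ = 0) : g y ^ 2 ≤ ∫ x in (0 : ℝ)..1, g' x ^ 2 := by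
  have h1 : ∫ x in x₀..y, g' x = g y := by
    rw [integral_eq_sub_of_hasDerivAt (fun x _ => hg x) (hg'.intervalIntegrable _ _), h0, sub_zero]
  have h2 : |g y| ≤ ∫ x in (0 : ℝ)..1, |g' x| := by
    rw [← h1]
    refine (norm_integral_le_integral_norm_uIoc (f := g')).trans ?_
    simp only [Real.norm_eq_abs]
    rw [integral_of_le zero_le_one]
    refine setIntegral_mono_set ?_ ?_ ?_
    · exact (hg'.abs.intervalIntegrable 0 1).1
    · exact Filter.Eventually.of_forall fun x => abs_nonneg _
    · exact LE.le.eventuallyLE (Ioc_subset_Ioc (le_min hx₀.1 hy.1) (max_le hx₀.2 hy.2))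
  calc g y ^ 2 = |g y| ^ 2 := (sq_abs _).symm
    _ ≤ (∫ x in (0 : ℝ)..1, |g' x|) ^ 2 := by gcongr
    _ ≤ ∫ x in (0 : ℝ)..1, |g' x| ^ 2 := sq_integral_le_integral_sq hg'.abs
    _ = _ := by simp only [sq_abs]

lemma descentTime_mem_Icc {ξ : ℝ → ℝ} {s T : ℝ} (hs : s ≤ T) :
    descentTime ξ s T ∈ Icc s T := by
  have hlb : s ∈ lowerBounds ({r : ℝ | s < r ∧ ξ r < ξ s} ∪ {T}) := by
    rintro r (hr | hr)
    · exact hr.1.le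
    · exact hr ▸ hs
  exact ⟨le_csInf ⟨T, by simp⟩ hlb, csInf_le ⟨s, hlb⟩ (by simp)⟩

lemma le_of_mem_Icc_descentTime {ξ : ℝ → ℝ} (hξ : Continuous ξ) {s T : ℝ} (hs : s ≤ T) :
    ∀ r ∈ Icc s (descentTime ξ s T), ξ s ≤ ξ r := by
  have hlb : s ∈ lowerBounds ({r : ℝ | s < r ∧ ξ r < ξ s} ∪ {T}) := by
    rintro r (hr | hr)
    · exact hr.1.le
    · exact hr ▸ hs
  have hIoo : ∀ r ∈ Ioo s (descentTime ξ s T), ξ s ≤ ξ r := by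
    intro r hr
    by_contra! hlt
    exact absurd (csInf_le ⟨s, hlb⟩ (Or.inl ⟨hr.1, hlt⟩)) (not_le.2 hr.2)
  intro r hr
  rcases eq_or_lt_of_le (hr.1.trans hr.2) with he | he
  · have : r = s := le_antisymm (hr.2.trans he.ge) hr.1
    rw [this]
  · exact le_on_closure (f := fun _ => ξ s) hIoo continuousOn_const hξ.continuousOn
      (by rwa [closure_Ioo he.ne])

lemma Function.Periodic.of_hasDerivAt {f f' : ℝ → ℝ} {c : ℝ} (hf : Function.Periodic f c)
    (h : ∀ x, HasDerivAt f (f' x) x) : Function.Periodic f' c := by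
  intro x
  have h1 : HasDerivAt (fun y => f (y + c)) (f' (x + c)) x := (h (x + c)).comp_add_const x c
  rw [funext hf] at h1
  exact h1.unique (h x)

lemma integral_eq_zero_of_periodic {f f' : ℝ → ℝ} (hf : Function.Periodic f 1)
    (h : ∀ x, HasDerivAt f (f' x) x) (hc : Continuous f') : ∫ x in (0 : ℝ)..1, f' x = 0 := by
  rw [integral_eq_sub_of_hasDerivAt (fun x _ => h x) (hc.intervalIntegrable _ _)]
  have := hf 0
  rw [zero_add] at this
  rw [this, sub_self]

lemma ContDiff.hasDerivAt_deriv_deriv {f : ℝ → ℝ} (hf : ContDiff ℝ 2 f) (x : ℝ) :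
    HasDerivAt (deriv f) (deriv (deriv f) x) x := by
  have h : ContDiff ℝ (1 + 1) f := by simpa [one_add_one_eq_two] using hf
  exact ((contDiff_succ_iff_deriv.1 h).2.2.differentiable one_ne_zero x).hasDerivAt

lemma ContDiff.continuous_deriv_deriv {f : ℝ → ℝ} (hf : ContDiff ℝ 2 f) :
    Continuous (deriv (deriv f)) := by
  have h : ContDiff ℝ (1 + 1) f := by simpa [one_add_one_eq_two] using hf
  exact (contDiff_succ_iff_deriv.1 h).2.2.continuous_deriv le_rfl

lemma ContDiff.hasDerivAt_deriv {f : ℝ → ℝ} (hf : ContDiff ℝ 2 f) (x : ℝ) :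
    HasDerivAt f (deriv f x) x :=
  (hf.differentiable two_ne_zero x).hasDerivAt

lemma ConvexOn.deriv_deriv_nonneg {f : ℝ → ℝ} (hf : ConvexOn ℝ univ f) (hd : Differentiable ℝ f)
    (x : ℝ) : 0 ≤ deriv (deriv f) x := by
  have h : Monotone (deriv f) := by
    have := hf.monotoneOn_deriv fun x _ => hd x
    rwa [monotoneOn_univ] at this
  exact h.deriv_nonneg

lemma ConvexOn.nonneg_of_even {f : ℝ → ℝ} (hf : ConvexOn ℝ univ f) (he : ∀ p, f (-p) = f p)
    (h0 : f 0 = 0) (p : ℝ) : 0 ≤ f p := by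
  have := hf.2 (mem_univ p) (mem_univ (-p)) (show (0 : ℝ) ≤ 1 / 2 by norm_num)
    (show (0 : ℝ) ≤ 1 / 2 by norm_num) (by norm_num)
  simp only [smul_eq_mul, he] at this
  have h1 : 1 / 2 * p + 1 / 2 * -p = 0 := by ring
  rw [h1, h0] at this
  linarith

/-- The primitive of a nonnegative even function, in absolute value, increases with `|p|`. -/
lemma abs_integral_le_of_abs_le {g : ℝ → ℝ} (hg : Continuous g) (hn : ∀ x, 0 ≤ g x)
    (he : ∀ x, g (-x) = g x) {p q : ℝ} (h : |p| ≤ |q|) :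
    |∫ w in (0 : ℝ)..p, g w| ≤ |∫ w in (0 : ℝ)..q, g w| := by
  have hodd : ∀ r, ∫ w in (0 : ℝ)..(-r), g w = -∫ w in (0 : ℝ)..r, g w := by
    intro r
    have := integral_comp_neg (a := 0) (b := r) g
    simp only [he, neg_zero] at this
    rw [this, integral_symm]
  have habs : ∀ r, |∫ w in (0 : ℝ)..r, g w| = ∫ w in (0 : ℝ)..|r|, g w := by
    intro r
    have hpos : 0 ≤ ∫ w in (0 : ℝ)..|r|, g w := integral_nonneg (abs_nonneg r) fun x _ => hn x
    rcases abs_cases r with ⟨h1, -⟩ | ⟨h1, -⟩ <;> rw [h1] at hpos ⊢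
    · exact abs_of_nonneg hpos
    · rw [hodd] at hpos ⊢
      exact abs_of_nonpos (by linarith)
  rw [habs, habs]
  exact integral_mono_interval le_rfl (abs_nonneg p) h
    (Filter.Eventually.of_forall hn) (hg.intervalIntegrable _ _)

namespace IsSmoothClassicalSolution

variable {T : ℝ} {ξ F H : ℝ → ℝ} {u ux uxx uxxx ut utx : ℝ → ℝ → ℝ}

lemma periodic_ux (hu : IsSmoothClassicalSolution (Icc 0 T) ξ F H u ux uxx uxxx ut utx)
    {t : ℝ} (ht : t ∈ Icc 0 T) : Function.Periodic (fun x => ux x t) 1 :=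
  Function.Periodic.of_hasDerivAt (fun x => hu.periodic x t) fun x => hu.deriv_x x t ht

lemma periodic_uxx (hu : IsSmoothClassicalSolution (Icc 0 T) ξ F H u ux uxx uxxx ut utx)
    {t : ℝ} (ht : t ∈ Icc 0 T) : Function.Periodic (fun x => uxx x t) 1 :=
  (hu.periodic_ux ht).of_hasDerivAt fun x => hu.deriv_xx x t ht

lemma hasDerivAt_t (hu : IsSmoothClassicalSolution (Icc 0 T) ξ F H u ux uxx uxxx ut utx)
    (x : ℝ) {t : ℝ} (ht : t ∈ Ioo 0 T) : HasDerivAt (fun s => u x s) (ut x t) t :=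
  (hu.deriv_t x t (Ioo_subset_Icc_self ht)).hasDerivAt (Icc_mem_nhds ht.1 ht.2)

lemma hasDerivAt_tx (hu : IsSmoothClassicalSolution (Icc 0 T) ξ F H u ux uxx uxxx ut utx)
    (x : ℝ) {t : ℝ} (ht : t ∈ Ioo 0 T) : HasDerivAt (fun s => ux x s) (utx x t) t :=
  (hu.deriv_tx x t (Ioo_subset_Icc_self ht)).hasDerivAt (Icc_mem_nhds ht.1 ht.2)

lemma ut_eq (hu : IsSmoothClassicalSolution (Icc 0 T) ξ F H u ux uxx uxxx ut utx)
    (hF : ContDiff ℝ 2 F) (x : ℝ) {t : ℝ} (ht : t ∈ Icc 0 T) :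
    ut x t = deriv F (ux x t) * uxx x t + H (ux x t) * deriv ξ t := by
  have h : HasDerivAt (fun y => F (ux y t)) (deriv F (ux x t) * uxx x t) x :=
    (hF.hasDerivAt_deriv (ux x t)).comp x (hu.deriv_xx x t ht)
  rw [hu.pde x t ht, h.deriv]

lemma hasDerivAt_ut (hu : IsSmoothClassicalSolution (Icc 0 T) ξ F H u ux uxx uxxx ut utx)
    (x : ℝ) {t : ℝ} (ht : t ∈ Ioo 0 T) : HasDerivAt (fun y => ut y t) (utx x t) x := by
  have hut : ∀ y, ut y t = ut 0 t + ∫ z in (0 : ℝ)..y, utx z t := by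
    intro y
    have h1 : HasDerivAt (fun s => u 0 s + ∫ z in (0 : ℝ)..y, ux z s)
        (ut 0 t + ∫ z in (0 : ℝ)..y, utx z t) t :=
      (hu.hasDerivAt_t 0 ht).add (hasDerivAt_integral_slice 0 y hu.cont_ux hu.cont_utx
        (fun z s hs => hu.hasDerivAt_tx z hs) ht)
    refine (hu.hasDerivAt_t y ht).unique (h1.congr_of_eventuallyEq ?_)
    filter_upwards [Icc_mem_nhds ht.1 ht.2] with s hs
    rw [integral_eq_sub_of_hasDerivAt (fun z _ => hu.deriv_x z s hs)
      ((continuous_slice hu.cont_ux hs).intervalIntegrable _ _)]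
    ring
  rw [funext hut]
  have hc := continuous_slice hu.cont_utx (Ioo_subset_Icc_self ht)
  exact (hc.integral_hasStrictDerivAt 0 x).hasDerivAt.const_add _

lemma utx_eq (hu : IsSmoothClassicalSolution (Icc 0 T) ξ F H u ux uxx uxxx ut utx)
    (hF : ContDiff ℝ 2 F) (hH : ContDiff ℝ 2 H) (x : ℝ) {t : ℝ} (ht : t ∈ Ioo 0 T) :
    utx x t = deriv (deriv F) (ux x t) * uxx x t * uxx x t + deriv F (ux x t) * uxxx x t
      + deriv H (ux x t) * uxx x t * deriv ξ t := by
  have ht' := Ioo_subset_Icc_self ht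
  have h1 := hu.hasDerivAt_ut x ht
  rw [funext fun y => hu.ut_eq hF y ht'] at h1
  refine h1.unique ?_
  have hx := hu.deriv_xx x t ht'
  exact (((hF.hasDerivAt_deriv_deriv (ux x t)).comp x hx).mul (hu.deriv_xxx x t ht')).add
    (((hH.hasDerivAt_deriv (ux x t)).comp x hx).mul_const _)

lemma u_le (hu : IsSmoothClassicalSolution (Icc 0 T) ξ F H u ux uxx uxxx ut utx)
    (hF : ContDiff ℝ 2 F) (hF' : ∀ r, 0 < deriv F r) (hH0 : H 0 = 0) {M : ℝ}
    (hM : ∀ x, u x 0 ≤ M) : ∀ x, ∀ t ∈ Icc 0 T, u x t ≤ M := by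
  refine le_of_parabolic_max_principle (fun t _ x => hu.periodic x t) hu.cont_u
    (fun x t ht => hu.deriv_x x t (Ioo_subset_Icc_self ht))
    (fun x t ht => hu.deriv_xx x t (Ioo_subset_Icc_self ht))
    (fun x t ht => hu.hasDerivAt_t x ht) (fun x t ht h0 h1 => ?_) hM
  rw [hu.ut_eq hF x (Ioo_subset_Icc_self ht), h0, hH0]
  nlinarith [hF' 0]

lemma le_u (hu : IsSmoothClassicalSolution (Icc 0 T) ξ F H u ux uxx uxxx ut utx)
    (hF : ContDiff ℝ 2 F) (hF' : ∀ r, 0 < deriv F r) (hH0 : H 0 = 0) {m : ℝ}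
    (hm : ∀ x, m ≤ u x 0) : ∀ x, ∀ t ∈ Icc 0 T, m ≤ u x t := by
  have := le_of_parabolic_max_principle (a := 0) (b := T) (M := -m) (w := fun x t => -u x t)
    (wx := fun x t => -ux x t) (wxx := fun x t => -uxx x t) (wt := fun x t => -ut x t)
    (fun t _ x => by simp only [hu.periodic x t]) hu.cont_u.neg
    (fun x t ht => (hu.deriv_x x t (Ioo_subset_Icc_self ht)).neg)
    (fun x t ht => (hu.deriv_xx x t (Ioo_subset_Icc_self ht)).neg)
    (fun x t ht => (hu.hasDerivAt_t x ht).neg) (fun x t ht h0 h1 => ?_)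
    (fun x => neg_le_neg (hm x))
  · exact fun x t ht => neg_le_neg_iff.1 (this x t ht)
  · rw [hu.ut_eq hF x (Ioo_subset_Icc_self ht), neg_eq_zero.1 h0, hH0]
    nlinarith [hF' 0]

/-- The maximum principle for `v = ∂ₓu`: its supremum norm is nonincreasing in time. -/
lemma abs_ux_le (hu : IsSmoothClassicalSolution (Icc 0 T) ξ F H u ux uxx uxxx ut utx)
    (hF : ContDiff ℝ 2 F) (hF' : ∀ r, 0 < deriv F r) (hH : ContDiff ℝ 2 H) {M t₀ : ℝ}
    (ht₀ : 0 ≤ t₀) (hM : ∀ x, |ux x t₀| ≤ M) : ∀ x, ∀ t ∈ Icc t₀ T, |ux x t| ≤ M := by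
  have hsub : Ioo t₀ T ⊆ Ioo 0 T := Ioo_subset_Ioo_left ht₀
  have hsub' : Icc t₀ T ⊆ Icc 0 T := Icc_subset_Icc_left ht₀
  have hcont := hu.cont_ux.mono (prod_mono (subset_refl univ) hsub')
  have h1 := le_of_parabolic_max_principle (a := t₀) (b := T) (M := M)
    (fun t ht => hu.periodic_ux (hsub' ht)) hcont
    (fun x t ht => hu.deriv_xx x t (hsub' (Ioo_subset_Icc_self ht)))
    (fun x t ht => hu.deriv_xxx x t (hsub' (Ioo_subset_Icc_self ht)))
    (fun x t ht => hu.hasDerivAt_tx x (hsub ht))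
    (fun x t ht h0 h1 => by
      rw [hu.utx_eq hF hH x (hsub ht), h0]
      nlinarith [hF' (ux x t)])
    (fun x => (abs_le.1 (hM x)).2)
  have h2 := le_of_parabolic_max_principle (a := t₀) (b := T) (M := M) (w := fun x t => -ux x t)
    (wx := fun x t => -uxx x t) (wxx := fun x t => -uxxx x t) (wt := fun x t => -utx x t)
    (fun t ht => (hu.periodic_ux (hsub' ht)).comp Neg.neg) hcont.neg
    (fun x t ht => (hu.deriv_xx x t (hsub' (Ioo_subset_Icc_self ht))).neg)
    (fun x t ht => (hu.deriv_xxx x t (hsub' (Ioo_subset_Icc_self ht))).neg)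
    (fun x t ht => (hu.hasDerivAt_tx x (hsub ht)).neg)
    (fun x t ht h0 h1 => by
      rw [hu.utx_eq hF hH x (hsub ht), neg_eq_zero.1 h0]
      nlinarith [hF' (ux x t)])
    (fun x => by linarith [(abs_le.1 (hM x)).1])
  exact fun x t ht => abs_le.2 ⟨by linarith [h2 x t ht], h1 x t ht⟩

lemma hasDerivAt_integral_u (hu : IsSmoothClassicalSolution (Icc 0 T) ξ F H u ux uxx uxxx ut utx)
    (hF : ContDiff ℝ 2 F) (hH : ContDiff ℝ 2 H) {t : ℝ} (ht : t ∈ Ioo 0 T) :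
    HasDerivAt (fun s => ∫ x in (0 : ℝ)..1, u x s)
      (deriv ξ t * ∫ x in (0 : ℝ)..1, H (ux x t)) t := by
  have ht' := Ioo_subset_Icc_self ht
  have hcx := continuous_slice hu.cont_ux ht'
  have hcxx := continuous_slice hu.cont_uxx ht'
  have hF1 : Continuous (deriv F) := hF.continuous_deriv one_le_two
  have hHc := hH.continuous
  convert hasDerivAt_integral_slice 0 1 hu.cont_u hu.cont_ut
    (fun x s hs => hu.hasDerivAt_t x hs) ht using 1
  have h0 : ∫ x in (0 : ℝ)..1, deriv F (ux x t) * uxx x t = 0 :=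
    integral_eq_zero_of_periodic (f := fun x => F (ux x t)) ((hu.periodic_ux ht').comp F)
      (fun x => (hF.hasDerivAt_deriv (ux x t)).comp x (hu.deriv_xx x t ht')) (by fun_prop)
  simp only [hu.ut_eq hF _ ht']
  rw [intervalIntegral.integral_add (Continuous.intervalIntegrable (by fun_prop) _ _)
    (Continuous.intervalIntegrable (by fun_prop) _ _), h0, zero_add,
    intervalIntegral.integral_mul_const, mul_comm]

/-- The energy dissipation identity. -/
lemma hasDerivAt_integral_H (hu : IsSmoothClassicalSolution (Icc 0 T) ξ F H u ux uxx uxxx ut utx)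
    (hF : ContDiff ℝ 2 F) (hH : ContDiff ℝ 2 H) {t : ℝ} (ht : t ∈ Ioo 0 T) :
    HasDerivAt (fun s => ∫ x in (0 : ℝ)..1, H (ux x s))
      (-∫ x in (0 : ℝ)..1, deriv F (ux x t) * deriv (deriv H) (ux x t) * uxx x t ^ 2) t := by
  have ht' := Ioo_subset_Icc_self ht
  have hcx := continuous_slice hu.cont_ux ht'
  have hcxx := continuous_slice hu.cont_uxx ht'
  have hcxxx := continuous_slice hu.cont_uxxx ht'
  have hF1 : Continuous (deriv F) := hF.continuous_deriv one_le_two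
  have hH1 : Continuous (deriv H) := hH.continuous_deriv one_le_two
  have hF2 := hF.continuous_deriv_deriv
  have hH2 := hH.continuous_deriv_deriv
  convert hasDerivAt_integral_slice 0 1 (f := fun x s => H (ux x s))
    (f' := fun x s => deriv H (ux x s) * utx x s)
    (hH.continuous.comp_continuousOn hu.cont_ux)
    ((hH1.comp_continuousOn hu.cont_ux).mul hu.cont_utx)
    (fun x s hs => (hH.hasDerivAt_deriv (ux x s)).comp s (hu.hasDerivAt_tx x hs)) ht using 1
  set K : ℝ → ℝ := fun p => ∫ q in (0 : ℝ)..p, deriv H q * deriv H q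
  have hK : ∀ p, HasDerivAt K (deriv H p * deriv H p) p := fun p =>
    ((hH1.mul hH1).integral_hasStrictDerivAt 0 p).hasDerivAt
  have h0 : ∫ x in (0 : ℝ)..1, (deriv (deriv H) (ux x t) * uxx x t * (deriv F (ux x t) * uxx x t)
      + deriv H (ux x t) * (deriv (deriv F) (ux x t) * uxx x t * uxx x t
        + deriv F (ux x t) * uxxx x t)
      + deriv H (ux x t) * deriv H (ux x t) * uxx x t * deriv ξ t) = 0 := by
    refine integral_eq_zero_of_periodic
      (f := fun x => deriv H (ux x t) * (deriv F (ux x t) * uxx x t) + K (ux x t) * deriv ξ t)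
      (fun x => ?_) (fun x => ?_) (by fun_prop)
    · have h1 : ux (x + 1) t = ux x t := hu.periodic_ux ht' x
      have h2 : uxx (x + 1) t = uxx x t := hu.periodic_uxx ht' x
      simp only [h1, h2]
    · have hx := hu.deriv_xx x t ht'
      exact (((hH.hasDerivAt_deriv_deriv (ux x t)).comp x hx).mul
        (((hF.hasDerivAt_deriv_deriv (ux x t)).comp x hx).mul (hu.deriv_xxx x t ht'))).add
        (((hK (ux x t)).comp x hx).mul_const _)
  have hctx := continuous_slice hu.cont_utx ht'
  rw [neg_eq_iff_add_eq_zero, ← intervalIntegral.integral_add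
    (Continuous.intervalIntegrable (by fun_prop) _ _)
    (Continuous.intervalIntegrable (by fun_prop) _ _)]
  refine (integral_congr fun x _ => ?_).trans h0
  simp only [hu.utx_eq hF hH x ht]
  ring

lemma sq_abs_le_dissipation (hu : IsSmoothClassicalSolution (Icc 0 T) ξ F H u ux uxx uxxx ut utx)
    (hF : ContDiff ℝ 2 F) (hF' : ∀ r, 0 < deriv F r) (hFodd : ∀ p, F (-p) = -F p)
    (hH : ContDiff ℝ 2 H) (hHconv : ConvexOn ℝ univ H) (hHeven : ∀ p, H (-p) = H p)
    {t : ℝ} (ht : t ∈ Icc 0 T) (x : ℝ) :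
    |∫ w in (0 : ℝ)..(ux x T), Real.sqrt (deriv F w * deriv (deriv H) w)| ^ 2 ≤
      ∫ x in (0 : ℝ)..1, deriv F (ux x t) * deriv (deriv H) (ux x t) * uxx x t ^ 2 := by
  have hcx := continuous_slice hu.cont_ux ht
  have hcxx := continuous_slice hu.cont_uxx ht
  have hF1 : Continuous (deriv F) := hF.continuous_deriv one_le_two
  have hH2 := hH.continuous_deriv_deriv
  set g : ℝ → ℝ := fun w => Real.sqrt (deriv F w * deriv (deriv H) w) with hg
  have hgc : Continuous g := by fun_prop
  have hgeven : ∀ p, g (-p) = g p := by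
    have h1 : ∀ p, deriv F (-p) = deriv F p := fun p => by
      have h := deriv_comp_neg F p
      rw [funext hFodd, deriv.fun_neg] at h
      linarith
    have h2 : ∀ p, deriv H (-p) = -deriv H p := fun p => by
      have h := deriv_comp_neg H p
      rw [funext hHeven] at h
      linarith
    have h3 : ∀ p, deriv (deriv H) (-p) = deriv (deriv H) p := fun p => by
      have h := deriv_comp_neg (deriv H) p
      rw [funext h2, deriv.fun_neg] at h
      linarith
    exact fun p => by simp only [hg, h1, h3]
  obtain ⟨y, hy, hmax⟩ := isCompact_Icc.exists_isMaxOn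
    (nonempty_Icc.2 zero_le_one) hcx.abs.continuousOn (s := Icc (0 : ℝ) 1)
  have hmax' : ∀ z, |ux z t| ≤ |ux y t| := by
    intro z
    obtain ⟨z', hz', h⟩ := (hu.periodic_ux ht).exists_mem_Ico₀ one_pos z
    have h' : ux z t = ux z' t := h
    rw [h']
    exact hmax ⟨hz'.1, hz'.2.le⟩
  have hle := abs_integral_le_of_abs_le hgc (fun _ => Real.sqrt_nonneg _) hgeven
    (hu.abs_ux_le hF hF' hH ht.1 hmax' x T ⟨ht.2, le_rfl⟩)
  obtain ⟨x₀, hx₀, hzero⟩ := exists_hasDerivAt_eq_zero (f := fun x => u x t)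
    (f' := fun x => ux x t) zero_lt_one
    (continuous_slice hu.cont_u ht).continuousOn
    (by simpa using (hu.periodic 0 t).symm) fun x _ => hu.deriv_x x t ht
  have hsob := sq_le_integral_sq_of_zero (g := fun x => ∫ w in (0 : ℝ)..(ux x t), g w)
    (g' := fun x => g (ux x t) * uxx x t)
    (fun x => (hgc.integral_hasStrictDerivAt 0 (ux x t)).hasDerivAt.comp
      (h₂ := fun p => ∫ w in (0 : ℝ)..p, g w) x (hu.deriv_xx x t ht))
    (by fun_prop) (Ioo_subset_Icc_self hx₀) hy (by simp only [hzero, integral_same])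
  calc _ ≤ |∫ w in (0 : ℝ)..(ux y t), g w| ^ 2 := by gcongr
    _ ≤ ∫ x in (0 : ℝ)..1, (g (ux x t) * uxx x t) ^ 2 := by rw [sq_abs]; exact hsob
    _ = _ := by
      refine integral_congr fun z _ => ?_
      simp only [hg, mul_pow]
      rw [Real.sq_sqrt (mul_nonneg (hF' _).le
        (hHconv.deriv_deriv_nonneg (hH.differentiable two_ne_zero) _))]

/-- The key estimate: dissipation on an interval on which `ξ` stays above its initial value is
controlled by the increase of the mean of `u`. -/
lemma mul_integral_le (hu : IsSmoothClassicalSolution (Icc 0 T) ξ F H u ux uxx uxxx ut utx)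
    (hξ : ContDiff ℝ 1 ξ) (hF : ContDiff ℝ 2 F) (hH : ContDiff ℝ 2 H) (hHn : ∀ p, 0 ≤ H p)
    {C s e : ℝ} (h0s : 0 ≤ s) (hse : s ≤ e) (heT : e ≤ T) (hξs : ∀ r ∈ Icc s e, ξ s ≤ ξ r)
    (hC : ∀ t ∈ Icc 0 T, C ≤
      ∫ x in (0 : ℝ)..1, deriv F (ux x t) * deriv (deriv H) (ux x t) * uxx x t ^ 2) :
    C * ∫ r in s..e, (ξ r - ξ s) ≤ (∫ x in (0 : ℝ)..1, u x e) - ∫ x in (0 : ℝ)..1, u x s := by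
  have hξc := hξ.continuous
  have hIcc : Icc s e ⊆ Icc 0 T := Icc_subset_Icc h0s heT
  have hIoo : Ioo s e ⊆ Ioo 0 T := Ioo_subset_Ioo h0s heT
  have hprim : ∀ t, HasDerivAt (fun t => ∫ r in s..t, (ξ r - ξ s)) (ξ t - ξ s) t := fun t =>
    ((hξc.sub continuous_const).integral_hasStrictDerivAt s t).hasDerivAt
  have hmono : MonotoneOn (fun t => (∫ x in (0 : ℝ)..1, u x t)
      - (ξ t - ξ s) * (∫ x in (0 : ℝ)..1, H (ux x t)) - C * ∫ r in s..t, (ξ r - ξ s))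
      (Icc s e) := by
    refine monotoneOn_of_hasDerivWithinAt_nonneg (f' := fun t => (ξ t - ξ s) *
      ((∫ x in (0 : ℝ)..1, deriv F (ux x t) * deriv (deriv H) (ux x t) * uxx x t ^ 2) - C))
      (convex_Icc s e) ?_ ?_ ?_
    · refine ContinuousOn.sub (ContinuousOn.sub ?_ (ContinuousOn.mul (by fun_prop) ?_)) ?_
      · exact (continuousOn_integral_slice 0 1 hu.cont_u).mono hIcc
      · exact (continuousOn_integral_slice 0 1 (f := fun x t => H (ux x t))
          (hH.continuous.comp_continuousOn hu.cont_ux)).mono hIcc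
      · exact fun t _ => ((hprim t).continuousAt.const_mul C).continuousWithinAt
    · intro t ht
      rw [interior_Icc] at ht
      have hd := (((hu.hasDerivAt_integral_u hF hH (hIoo ht)).sub
        ((((hξ.differentiable one_ne_zero t).hasDerivAt).sub_const (ξ s)).mul
          (hu.hasDerivAt_integral_H hF hH (hIoo ht)))).sub ((hprim t).const_mul C))
      refine HasDerivAt.hasDerivWithinAt (hd.congr_deriv ?_)
      ring
    · intro t ht
      rw [interior_Icc] at ht
      have ht' := Ioo_subset_Icc_self ht
      exact mul_nonneg (sub_nonneg.2 (hξs t ht')) (sub_nonneg.2 (hC t (hIcc ht')))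
  have h := hmono (left_mem_Icc.2 hse) (right_mem_Icc.2 hse) hse
  simp only [sub_self, zero_mul, integral_same, mul_zero, sub_zero] at h
  have hpos : 0 ≤ (ξ e - ξ s) * ∫ x in (0 : ℝ)..1, H (ux x e) :=
    mul_nonneg (sub_nonneg.2 (hξs e (right_mem_Icc.2 hse)))
      (integral_nonneg zero_le_one fun x _ => hHn _)
  linarith

/-- The increments of the mean of `u` are bounded by the initial oscillation. -/
lemma integral_sub_integral_le_oscOn
    (hu : IsSmoothClassicalSolution (Icc 0 T) ξ F H u ux uxx uxxx ut utx)
    (hF : ContDiff ℝ 2 F) (hF' : ∀ r, 0 < deriv F r) (hH0 : H 0 = 0) {s e : ℝ}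
    (hs : s ∈ Icc 0 T) (he : e ∈ Icc 0 T) :
    (∫ x in (0 : ℝ)..1, u x e) - ∫ x in (0 : ℝ)..1, u x s ≤ oscOn (fun x => u x 0) 0 1 := by
  have hc := continuous_slice hu.cont_u (left_mem_Icc.2 (hs.1.trans hs.2))
  have hK : IsCompact ((fun x => u x 0) '' Icc (0 : ℝ) 1) := isCompact_Icc.image hc
  have hmem : ∀ x, u x 0 ∈ (fun x => u x 0) '' Icc (0 : ℝ) 1 := by
    intro x
    have hp : Function.Periodic (fun x => u x 0) 1 := fun x => hu.periodic x 0
    obtain ⟨y, hy, h⟩ := hp.exists_mem_Ico₀ one_pos x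
    exact ⟨y, ⟨hy.1, hy.2.le⟩, h.symm⟩
  have h1 : ∫ x in (0 : ℝ)..1, u x e ≤ ∫ _ in (0 : ℝ)..1, sSup ((fun x => u x 0) '' Icc (0 : ℝ) 1) :=
    integral_mono zero_le_one ((continuous_slice hu.cont_u he).intervalIntegrable _ _)
      intervalIntegrable_const fun x =>
        hu.u_le hF hF' hH0 (fun x => le_csSup hK.bddAbove (hmem x)) x e he
  have h2 : ∫ _ in (0 : ℝ)..1, sInf ((fun x => u x 0) '' Icc (0 : ℝ) 1) ≤ ∫ x in (0 : ℝ)..1, u x s :=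
    integral_mono zero_le_one intervalIntegrable_const
      ((continuous_slice hu.cont_u hs).intervalIntegrable _ _) fun x =>
        hu.le_u hF hF' hH0 (fun x => csInf_le hK.bddBelow (hmem x)) x s hs
  simp only [intervalIntegral.integral_const, sub_zero, one_smul] at h1 h2
  unfold oscOn
  linarith

end IsSmoothClassicalSolution

/-- Let `T > 0`, `ξ ∈ C¹([0,T])`, `H ∈ C²(ℝ)` convex and even with
`H 0 = 0`, `F ∈ C²(ℝ)` odd with `F' > 0`, and set `G r := ∫_0^r (F'(w) H''(w))^{1/2} dw`.
Let `u` be a smooth classical solution of `du = ∂ₓ(F(∂ₓu)) dt + H(∂ₓu) dξ` on `𝕋 × [0,T]`.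
Then, whenever `Γ(ξ)_{0,T} > 0`,
`‖G(∂ₓu(·,T))‖_∞² ≤ osc(u(·,0)) / Γ(ξ)_{0,T}`. -/
theorem fluctuations_dissipation_interaction (T : ℝ) (hT : 0 < T)
    (ξ F H : ℝ → ℝ) (hξ : ContDiff ℝ 1 ξ)
    (hH : ContDiff ℝ 2 H) (hHconv : ConvexOn ℝ Set.univ H)
    (hHeven : ∀ p : ℝ, H (-p) = H p) (hH0 : H 0 = 0)
    (hF : ContDiff ℝ 2 F) (hFodd : ∀ p : ℝ, F (-p) = -F p)
    (hF' : ∀ r : ℝ, 0 < deriv F r)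
    (u ux uxx uxxx ut utx : ℝ → ℝ → ℝ)
    (hu : IsSmoothClassicalSolution (Set.Icc 0 T) ξ F H u ux uxx uxxx ut utx)
    (hΓ : 0 < Gamma ξ 0 T) :
    (sSup ((fun x =>
        |∫ w in (0 : ℝ)..(ux x T), Real.sqrt (deriv F w * deriv (deriv H) w)|) ''
          Set.Icc (0 : ℝ) 1)) ^ 2
      ≤ oscOn (fun x => u x 0) 0 1 / Gamma ξ 0 T := by
  set C := sSup ((fun x =>
        |∫ w in (0 : ℝ)..(ux x T), Real.sqrt (deriv F w * deriv (deriv H) w)|) ''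
          Set.Icc (0 : ℝ) 1)
  have hC0 : 0 ≤ C := Real.sSup_nonneg (by rintro _ ⟨x, -, rfl⟩; exact abs_nonneg _)
  have hC : ∀ t ∈ Icc 0 T, C ^ 2 ≤
      ∫ x in (0 : ℝ)..1, deriv F (ux x t) * deriv (deriv H) (ux x t) * uxx x t ^ 2 := by
    intro t ht
    have hle := hu.sq_abs_le_dissipation hF hF' hFodd hH hHconv hHeven ht
    rw [← Real.le_sqrt hC0 ((sq_nonneg _).trans (hle 0))]
    refine csSup_le ((nonempty_Icc.2 zero_le_one).image _) ?_
    rintro _ ⟨x, -, rfl⟩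
    exact Real.le_sqrt_of_sq_le (hle x)
  have key : ∀ s ∈ Icc 0 T, C ^ 2 * ∫ r in s..(descentTime ξ s T), (ξ r - ξ s)
      ≤ oscOn (fun x => u x 0) 0 1 := by
    intro s hs
    have he := descentTime_mem_Icc (ξ := ξ) hs.2
    exact (hu.mul_integral_le hξ hF hH (hHconv.nonneg_of_even hHeven hH0) hs.1 he.1 he.2
      (le_of_mem_Icc_descentTime hξ.continuous hs.2) hC).trans
      (hu.integral_sub_integral_le_oscOn hF hF' hH0 hs ⟨hs.1.trans he.1, he.2⟩)
  have hosc : 0 ≤ oscOn (fun x => u x 0) 0 1 := by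
    have h0 : (0 : ℝ) ∈ Icc 0 T := left_mem_Icc.2 hT.le
    simpa using hu.integral_sub_integral_le_oscOn hF hF' hH0 h0 h0
  rw [le_div_iff₀ hΓ]
  rcases (sq_nonneg C).eq_or_lt with h0 | h0
  · rwa [← h0, zero_mul]
  · rw [← le_div_iff₀' h0]
    refine csSup_le ((nonempty_Icc.2 hT.le).image _) ?_
    rintro _ ⟨s, hs, rfl⟩
    exact (le_div_iff₀' h0).2 (key s hs)
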